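/- arXiv:0708.4176 — 2 statements merged into one kernel-verified Lean document; each statement's English description precedes it below -/
import Mathlib

section
/- Let ξ be a countable ordinal with 3 ≤ ξ < ω₁. Then the sets Σ_ξ and Π_ξ, viewed as subsets of 2^{2^{<ω}}, are Π^1_1-hard (every coanalytic subset of every zero-dimensional Polish space is a continuous preimage of each of them); moreover they are Σ^1_2 but not analytic. -/
open Topology MeasureTheory TopologicalSpace

abbrev Cantor : Type := ℕ → Fin 2

/-- The concatenation of the first `m` words of the sequence `a`. -/
def concatPrefix {β : Type*} (a : ℕ → List β) (m : ℕ) : List β :=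
  ((List.range m).map a).flatten

/-- The ω-power of a set `A` of finite words: the set of all infinite words obtained by
concatenating a sequence of words of `A` (infinitely many of them being nonempty). -/
def omegaPower {β : Type*} (A : Set (List β)) : Set (ℕ → β) :=
  {α | ∃ a : ℕ → List β, (∀ i, a i ∈ A) ∧
    (∀ n, ∃ m, n ≤ (concatPrefix a m).length) ∧
    ∀ (m k : ℕ) (h : k < (concatPrefix a m).length), (concatPrefix a m).get ⟨k, h⟩ = α k}

/-- The Borel class Σ⁰_ξ of a topological space: Σ⁰_ξ is the class of open sets for ξ ≤ 1,
and for ξ ≥ 2 it consists of the countable unions of sets each lying in some Π⁰_η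
with 1 ≤ η < ξ. -/
noncomputable def SigmaZero (X : Type*) [TopologicalSpace X] (ξ : Ordinal.{0}) : Set (Set X) :=
  if ξ ≤ 1 then {s | IsOpen s}
  else {s | ∃ f : ℕ → Set X,
    (∀ n, ∃ η : Ordinal.{0}, ∃ _ : 1 ≤ η, ∃ _ : η < ξ, (f n)ᶜ ∈ SigmaZero X η) ∧
    s = ⋃ n, f n}
termination_by ξ

/-- The Borel class Π⁰_ξ: complements of Σ⁰_ξ sets. -/
noncomputable def PiZero (X : Type*) [TopologicalSpace X] (ξ : Ordinal.{0}) : Set (Set X) :=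
  {s | sᶜ ∈ SigmaZero X ξ}

/-- A topological space is zero-dimensional if it has a basis consisting of clopen sets. -/
def ZeroDim (X : Type*) [TopologicalSpace X] : Prop :=
  ∃ b : Set (Set X), IsTopologicalBasis b ∧ ∀ s ∈ b, IsClopen s

/-- A set is coanalytic (Π¹₁) if its complement is analytic. -/
def Coanalytic {X : Type*} [TopologicalSpace X] (P : Set X) : Prop :=
  MeasureTheory.AnalyticSet Pᶜ

/-- A set is Σ¹₂ if it is the projection of a coanalytic subset of `X × ω^ω`. -/
def Sigma12 {X : Type*} [TopologicalSpace X] (P : Set X) : Prop :=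
  ∃ Q : Set (X × (ℕ → ℕ)), Coanalytic Q ∧ P = Prod.fst '' Q

/-- A set is Π¹₂ if its complement is Σ¹₂. -/
def Pi12 {X : Type*} [TopologicalSpace X] (P : Set X) : Prop :=
  Sigma12 Pᶜ

/-- The set of dictionaries whose ω-power is Σ⁰_ξ, as a subset of `2^{2^{<ω}}`. -/
def SigmaDict (ξ : Ordinal.{0}) : Set (List (Fin 2) → Bool) :=
  {A | omegaPower {w | A w = true} ∈ SigmaZero Cantor ξ}

/-- The set of dictionaries whose ω-power is Π⁰_ξ, as a subset of `2^{2^{<ω}}`. -/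
def PiDict (ξ : Ordinal.{0}) : Set (List (Fin 2) → Bool) :=
  {A | omegaPower {w | A w = true} ∈ PiZero Cantor ξ}

/-! ### Prepending finite words to infinite words -/

/-- Prepend a letter to an infinite word. -/
def scons {β : Type*} (a : β) (γ : ℕ → β) : ℕ → β
  | 0 => a
  | n + 1 => γ n

/-- Prepend a finite word to an infinite word. -/
def app {β : Type*} (u : List β) (γ : ℕ → β) : ℕ → β := u.foldr scons γ

/-- Drop the first `n` letters of an infinite word. -/
def shift {β : Type*} (n : ℕ) (γ : ℕ → β) : ℕ → β := fun k => γ (n + k)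

section app

variable {β : Type*}

@[simp] theorem app_nil (γ : ℕ → β) : app [] γ = γ := rfl

@[simp] theorem app_cons (a : β) (u : List β) (γ : ℕ → β) :
    app (a :: u) γ = scons a (app u γ) := rfl

theorem app_append (u v : List β) (γ : ℕ → β) : app (u ++ v) γ = app u (app v γ) := by
  simp [app]

@[simp] theorem scons_inj {a b : β} {γ δ : ℕ → β} :
    scons a γ = scons b δ ↔ a = b ∧ γ = δ := by
  constructor
  · intro h
    exact ⟨congrFun h 0, funext fun n => congrFun h (n + 1)⟩
  · rintro ⟨rfl, rfl⟩
    rfl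

theorem app_left_cancel {u : List β} {γ δ : ℕ → β} (h : app u γ = app u δ) : γ = δ := by
  induction u with
  | nil => exact h
  | cons a u ih => exact ih (scons_inj.1 h).2

theorem shift_app (u : List β) (γ : ℕ → β) : shift u.length (app u γ) = γ := by
  induction u with
  | nil => funext k; simp [shift]
  | cons a u ih =>
    funext k
    have := congrFun ih k
    simp only [shift, List.length_cons, app_cons] at this ⊢
    rw [show u.length + 1 + k = (u.length + k) + 1 by omega]
    exact this

theorem scons_head_shift (α : ℕ → β) : scons (α 0) (shift 1 α) = α := by
  funext n
  cases n with
  | zero => rfl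
  | succ n => simp [scons, shift, Nat.add_comm]

theorem exists_eq_app_iff (u : List β) (α : ℕ → β) :
    (∃ γ, α = app u γ) ↔ ∀ (k : ℕ) (h : k < u.length), u.get ⟨k, h⟩ = α k := by
  induction u generalizing α with
  | nil => simp
  | cons a u ih =>
    constructor
    · rintro ⟨γ, rfl⟩ k h
      cases k with
      | zero => rfl
      | succ k => exact (ih _).1 ⟨γ, rfl⟩ k (by simpa using h)
    · intro h
      obtain ⟨γ, hγ⟩ := (ih (shift 1 α)).2 fun k hk => by
        have := h (k + 1) (by simpa using hk)
        simpa [shift, Nat.add_comm] using this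
      refine ⟨γ, ?_⟩
      rw [app_cons, ← hγ, ← scons_head_shift α]
      have := h 0 (by simp)
      simp only [scons_inj]
      exact ⟨this.symm, by rw [scons_head_shift]⟩

end app

/-! ### The ω-power as a greatest fixed point -/

section omegaPower

variable {β : Type*} {A : Set (List β)}

theorem concatPrefix_succ (a : ℕ → List β) (m : ℕ) :
    concatPrefix a (m + 1) = concatPrefix a m ++ a m := by
  simp [concatPrefix, List.range_succ]

theorem concatPrefix_succ' (a : ℕ → List β) (m : ℕ) :
    concatPrefix a (m + 1) = a 0 ++ concatPrefix (fun i => a (i + 1)) m := by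
  simp [concatPrefix, List.range_succ_eq_map, Function.comp_def]

theorem mem_omegaPower_iff {α : ℕ → β} :
    α ∈ omegaPower A ↔ ∃ a : ℕ → List β, (∀ i, a i ∈ A) ∧
      (∀ n, ∃ m, n ≤ (concatPrefix a m).length) ∧ ∀ m, ∃ γ, α = app (concatPrefix a m) γ := by
  simp only [omegaPower, Set.mem_ofPred_eq, exists_eq_app_iff]

theorem app_concatPrefix {a : ℕ → List β} {α : ℕ → ℕ → β}
    (h : ∀ k, α k = app (a k) (α (k + 1))) (m : ℕ) : α 0 = app (concatPrefix a m) (α m) := by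
  induction m with
  | zero => rfl
  | succ m ih => rw [concatPrefix_succ, app_append, ← h, ← ih]

theorem le_length_concatPrefix {a : ℕ → List β} (h : ∀ k, a k ≠ []) (m : ℕ) :
    m ≤ (concatPrefix a m).length := by
  induction m with
  | zero => simp
  | succ m ih =>
    have := List.length_pos_iff.2 (h m)
    rw [concatPrefix_succ, List.length_append]
    omega

/-- Any set of infinite words from which nonempty words of `A` can be split off without
leaving the set is contained in the ω-power of `A`. -/
theorem subset_omegaPower {U : Set (ℕ → β)}
    (h : ∀ α ∈ U, ∃ u ∈ A, u ≠ [] ∧ ∃ γ ∈ U, α = app u γ) : U ⊆ omegaPower A := by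
  intro α hα
  choose! u hu hne γ hγ heq using h
  let s : ℕ → ℕ → β := fun k => γ^[k] α
  have hs : ∀ k, s k ∈ U := by
    intro k
    induction k with
    | zero => exact hα
    | succ k ih => simp only [s, Function.iterate_succ_apply'] at ih ⊢; exact hγ _ ih
  refine mem_omegaPower_iff.2 ⟨fun k => u (s k), fun k => hu _ (hs k),
    fun n => ⟨n, le_length_concatPrefix (fun k => hne _ (hs k)) n⟩, fun m => ⟨s m, ?_⟩⟩
  refine app_concatPrefix (α := s) (fun k => ?_) m
  simp only [s, Function.iterate_succ_apply']
  exact heq _ (hs k)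

theorem exists_app_of_mem_omegaPower {α : ℕ → β} (hα : α ∈ omegaPower A) :
    ∃ u ∈ A, u ≠ [] ∧ ∃ γ ∈ omegaPower A, α = app u γ := by
  obtain ⟨a, ha, hlen, hpre⟩ := mem_omegaPower_iff.1 hα
  have hex : ∃ N, a N ≠ [] := by
    by_contra! hcon
    obtain ⟨m, hm⟩ := hlen 1
    have h0 : concatPrefix a m = [] := by
      simp only [concatPrefix, List.flatten_eq_nil_iff, List.mem_map]
      rintro _ ⟨i, -, rfl⟩
      exact hcon i
    simp [h0] at hm
  obtain ⟨N, hN⟩ := hex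
  have tail : ∀ (a : ℕ → List β) (α : ℕ → β), (∀ i, a i ∈ A) →
      (∀ n, ∃ m, n ≤ (concatPrefix a m).length) → (∀ m, ∃ γ, α = app (concatPrefix a m) γ) →
      ∃ δ, α = app (a 0) δ ∧ (∀ n, ∃ m, n ≤ (concatPrefix (fun i => a (i + 1)) m).length) ∧
        ∀ m, ∃ γ, δ = app (concatPrefix (fun i => a (i + 1)) m) γ := by
    intro a α _ hlen hpre
    obtain ⟨δ, hδ⟩ := hpre 1
    have hδ' : α = app (a 0) δ := by simpa [concatPrefix] using hδ
    refine ⟨δ, hδ', fun n => ?_, fun m => ?_⟩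
    · obtain ⟨m, hm⟩ := hlen (n + (a 0).length)
      cases m with
      | zero => simp [concatPrefix] at hm; exact ⟨0, by omega⟩
      | succ m =>
        rw [concatPrefix_succ', List.length_append] at hm
        exact ⟨m, by omega⟩
    · obtain ⟨γ, hγ⟩ := hpre (m + 1)
      rw [concatPrefix_succ', app_append, hδ'] at hγ
      exact ⟨γ, app_left_cancel hγ⟩
  clear hα
  induction N generalizing a with
  | zero =>
    obtain ⟨δ, h1, h2, h3⟩ := tail a α ha hlen hpre
    exact ⟨a 0, ha 0, hN, δ, mem_omegaPower_iff.2 ⟨_, fun i => ha _, h2, h3⟩, h1⟩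
  | succ N ih =>
    obtain ⟨δ, h1, h2, h3⟩ := tail a α ha hlen hpre
    by_cases h0 : a 0 = []
    · have : α = δ := by simpa [h0] using h1
      subst this
      exact ih (fun i => a (i + 1)) (fun i => ha _) h2 h3 hN
    · exact ⟨a 0, ha 0, h0, δ, mem_omegaPower_iff.2 ⟨_, fun i => ha _, h2, h3⟩, h1⟩

theorem mem_omegaPower_iff_exists_seq {α : ℕ → β} :
    α ∈ omegaPower A ↔ ∃ (w : ℕ → List β) (s : ℕ → ℕ → β), s 0 = α ∧
      ∀ k, w k ∈ A ∧ w k ≠ [] ∧ s k = app (w k) (s (k + 1)) := by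
  constructor
  · intro hα
    have step := fun (γ : ℕ → β) (hγ : γ ∈ omegaPower A) => exists_app_of_mem_omegaPower hγ
    choose! u hu hne γ hγ heq using step
    have hs : ∀ k, γ^[k] α ∈ omegaPower A := by
      intro k
      induction k with
      | zero => exact hα
      | succ k ih => rw [Function.iterate_succ_apply']; exact hγ _ ih
    refine ⟨fun k => u (γ^[k] α), fun k => γ^[k] α, rfl, fun k => ⟨hu _ (hs k), hne _ (hs k), ?_⟩⟩
    simp only [Function.iterate_succ_apply']
    exact heq _ (hs k)
  · rintro ⟨w, s, rfl, h⟩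
    refine subset_omegaPower (U := Set.range s) ?_ ⟨0, rfl⟩
    rintro _ ⟨k, rfl⟩
    exact ⟨w k, (h k).1, (h k).2.1, s (k + 1), ⟨_, rfl⟩, (h k).2.2⟩

theorem omegaPower_eq_iff {U : Set (ℕ → β)} :
    omegaPower A = U ↔ omegaPower A ⊆ U ∧
      ∀ α ∈ U, ∃ u ∈ A, u ≠ [] ∧ ∃ γ ∈ U, α = app u γ := by
  constructor
  · rintro rfl
    exact ⟨subset_rfl, fun α hα => exists_app_of_mem_omegaPower hα⟩
  · rintro ⟨h1, h2⟩
    exact h1.antisymm (subset_omegaPower h2)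

end omegaPower

/-! ### Coding words over `ℕ` by binary words -/

/-- The binary code `0ⁿ1` of a natural number. -/
def codeNat (n : ℕ) : List (Fin 2) := List.replicate n 0 ++ [1]

/-- The binary code of a finite word over `ℕ`. -/
def code (w : List ℕ) : List (Fin 2) := w.flatMap codeNat

@[simp] theorem code_nil : code [] = [] := rfl

@[simp] theorem code_cons (a : ℕ) (w : List ℕ) : code (a :: w) = codeNat a ++ code w := by
  simp [code]

@[simp] theorem code_append (v w : List ℕ) : code (v ++ w) = code v ++ code w := by
  simp [code]

theorem codeNat_ne_nil (n : ℕ) : codeNat n ≠ [] := by simp [codeNat]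

theorem code_ne_nil {w : List ℕ} (h : w ≠ []) : code w ≠ [] := by
  cases w with
  | nil => exact absurd rfl h
  | cons a w => simp [codeNat_ne_nil]

theorem codeNat_succ (n : ℕ) : codeNat (n + 1) = 0 :: codeNat n := by
  simp [codeNat, List.replicate_succ]

theorem app_codeNat_inj {m n : ℕ} {α β : Cantor} (h : app (codeNat m) α = app (codeNat n) β) :
    m = n ∧ α = β := by
  induction m generalizing n with
  | zero =>
    cases n with
    | zero => simpa [codeNat] using h
    | succ n => simp [codeNat, List.replicate_succ] at h
  | succ m ih =>
    cases n with
    | zero => simp [codeNat, List.replicate_succ] at h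
    | succ n =>
      simp only [codeNat_succ, app_cons, scons_inj, true_and] at h
      obtain ⟨rfl, rfl⟩ := ih h
      exact ⟨rfl, rfl⟩

theorem exists_append_of_app_code {v w : List ℕ} {α β : Cantor} (hlen : v.length ≤ w.length)
    (h : app (code v) α = app (code w) β) : ∃ t, w = v ++ t ∧ α = app (code t) β := by
  induction v generalizing w with
  | nil => exact ⟨w, rfl, h⟩
  | cons a v ih =>
    cases w with
    | nil => simp at hlen
    | cons b w =>
      rw [code_cons, code_cons, app_append, app_append] at h
      obtain ⟨rfl, h'⟩ := app_codeNat_inj h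
      obtain ⟨t, rfl, ht⟩ := ih (by simpa using hlen) h'
      exact ⟨t, rfl, ht⟩

theorem app_code_inj_of_length {v w : List ℕ} {α β : Cantor} (hlen : v.length = w.length)
    (h : app (code v) α = app (code w) β) : v = w ∧ α = β := by
  obtain ⟨t, rfl, ht⟩ := exists_append_of_app_code hlen.le h
  have : t = [] := by simpa using hlen
  subst this
  exact ⟨by simp, ht⟩

theorem code_injective : Function.Injective code := by
  intro v w h
  wlog hlen : v.length ≤ w.length generalizing v w
  · exact (this h.symm (by omega)).symm
  obtain ⟨t, rfl, -⟩ := exists_append_of_app_code (α := fun _ => 0) (β := fun _ => 0) hlen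
    (by rw [h])
  rw [code_append, List.self_eq_append_right] at h
  by_cases ht : t = []
  · simp [ht]
  · exact absurd h (code_ne_nil ht)

/-- The binary code `0^{γ 0} 1 0^{γ 1} 1 ⋯` of an infinite word over `ℕ`. -/
def codeSeq : ℕ → (ℕ → ℕ) → Fin 2
  | 0, γ => if γ 0 = 0 then 1 else 0
  | n + 1, γ => if γ 0 = 0 then codeSeq n (shift 1 γ) else codeSeq n (scons (γ 0 - 1) (shift 1 γ))

/-- `codeSeq` as an element of the Cantor space. -/
def codeInf (γ : ℕ → ℕ) : Cantor := fun n => codeSeq n γ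

theorem shift_one_scons {β : Type*} (a : β) (γ : ℕ → β) : shift 1 (scons a γ) = γ := by
  funext n
  simp [shift, Nat.add_comm 1 n, scons]

theorem codeInf_scons (a : ℕ) (γ : ℕ → ℕ) :
    codeInf (scons a γ) = app (codeNat a) (codeInf γ) := by
  induction a with
  | zero =>
    funext n
    cases n with
    | zero => simp [codeInf, codeSeq, codeNat, scons]
    | succ n => simp [codeInf, codeSeq, codeNat, scons, shift_one_scons]
  | succ a ih =>
    rw [codeNat_succ, app_cons, ← ih]
    funext n
    cases n with
    | zero => simp [codeInf, codeSeq, scons]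
    | succ n => simp [codeInf, codeSeq, scons, shift_one_scons]

theorem measurable_shift {β : Type*} [MeasurableSpace β] (n : ℕ) :
    Measurable (shift n : (ℕ → β) → (ℕ → β)) :=
  measurable_pi_lambda _ fun _ => measurable_pi_apply _

theorem measurable_codeSeq (n : ℕ) : Measurable (codeSeq n) := by
  have h0 : MeasurableSet {γ : ℕ → ℕ | γ 0 = 0} :=
    measurable_pi_apply (X := fun _ : ℕ => ℕ) 0 (measurableSet_singleton 0)
  induction n with
  | zero => exact Measurable.ite h0 measurable_const measurable_const
  | succ n ih =>
    refine Measurable.ite h0 (ih.comp (measurable_shift 1)) (ih.comp ?_)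
    refine measurable_pi_lambda _ fun k => ?_
    cases k with
    | zero => exact (measurable_from_nat (f := fun m : ℕ => m - 1)).comp (measurable_pi_apply 0)
    | succ k => exact measurable_pi_apply _

theorem measurable_codeInf : Measurable codeInf :=
  measurable_pi_lambda _ measurable_codeSeq

/-! ### The dictionary attached to a binary relation -/

/-- Two letters, coding natural numbers with a bit, code consecutive natural numbers. -/
def Consec (a c : ℕ) : Prop := c / 2 = a / 2 + 1

/-- The words over `ℕ` that consist of consecutive letters, and whose first letter is related
to the natural number following the last letter. -/
def chainWords (Rel : ℕ → ℕ → Prop) : Set (List ℕ) :=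
  {w | w.IsChain Consec ∧ ∃ a t, w = a :: t ∧ Rel a (a / 2 + w.length)}

/-- The binary dictionary attached to a relation. -/
def chainDict (Rel : ℕ → ℕ → Prop) : Set (List (Fin 2)) := code '' chainWords Rel

theorem consec_getLast {a : ℕ} {t v : List ℕ} {l : ℕ} (h : (a :: t).IsChain Consec)
    (heq : a :: t = v ++ [l]) : l / 2 = a / 2 + v.length := by
  induction t generalizing a v with
  | nil =>
    cases v with
    | nil => simp at heq; simp [heq]
    | cons b v => simp at heq
  | cons b t ih =>
    cases v with
    | nil => simp at heq
    | cons c v =>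
      simp only [List.cons_append, List.cons.injEq] at heq
      obtain ⟨rfl, heq⟩ := heq
      rw [List.isChain_cons_cons] at h
      have h1 := ih h.2 heq
      have h2 : b / 2 = a / 2 + 1 := h.1
      simp only [List.length_cons]
      omega

/-- A finite word and a letter that cannot be consecutive inside a word of `chainWords`. -/
def Break (v : List ℕ) (m : ℕ) : Prop := ∃ v' l, v = v' ++ [l] ∧ ¬ Consec l m

theorem Break.of_append {u v : List ℕ} {m : ℕ} (h : Break (u ++ v) m) (hv : v ≠ []) :
    Break v m := by
  obtain ⟨v', l, heq, hl⟩ := h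
  refine ⟨v.dropLast, v.getLast hv, (List.dropLast_append_getLast hv).symm, ?_⟩
  have : v.getLast hv = l := by
    have h1 : (u ++ v).getLast (by simp [hv]) = v.getLast hv := by simp [hv]
    rw [← h1]
    simp [heq]
  rwa [this]

theorem Break.append {u v : List ℕ} {m : ℕ} (h : Break v m) : Break (u ++ v) m := by
  obtain ⟨v', l, rfl, hl⟩ := h
  exact ⟨u ++ v', l, by simp, hl⟩

/-- A break is a cut of any factorization into words of consecutive letters. -/
theorem exists_cut_of_break {L : List (List ℕ)} (hL : ∀ b ∈ L, b.IsChain Consec)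
    {v t : List ℕ} {m : ℕ} (h : L.flatten = v ++ m :: t) (hb : Break v m) :
    ∃ L₁ L₂, L = L₁ ++ L₂ ∧ L₁.flatten = v := by
  induction L generalizing v with
  | nil => simp at h
  | cons b L ih =>
    rw [List.flatten_cons, List.append_eq_append_iff] at h
    rcases h with ⟨a', rfl, h⟩ | ⟨c', rfl, h⟩
    · by_cases ha : a' = []
      · exact ⟨[b], L, rfl, by simp [ha]⟩
      · obtain ⟨L₁, L₂, rfl, rfl⟩ :=
          ih (fun b hb => hL b (List.mem_cons_of_mem _ hb)) h (hb.of_append ha)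
        exact ⟨b :: L₁, L₂, rfl, by simp⟩
    · cases c' with
      | nil => exact ⟨[v], L, by simp, by simp⟩
      | cons d c' =>
        simp only [List.cons_append, List.cons.injEq] at h
        obtain ⟨rfl, -⟩ := h
        obtain ⟨v', l, rfl, hl⟩ := hb
        have := hL _ List.mem_cons_self
        rw [List.append_assoc] at this
        have h2 := this.right_of_append
        simp only [List.singleton_append, List.isChain_cons_cons] at h2
        exact absurd h2.1 hl

/-- The infinite words having arbitrarily long prefixes that end just after a break. -/
def breakSet (Rel : ℕ → ℕ → Prop) : Set Cantor :=
  {α | ∀ N, ∃ (L : List (List ℕ)) (m : ℕ) (γ : Cantor), (∀ b ∈ L, b ∈ chainWords Rel) ∧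
    N ≤ L.flatten.length ∧ Break L.flatten m ∧ α = app (code (L.flatten ++ [m])) γ}

theorem ne_nil_of_mem_chainWords {Rel : ℕ → ℕ → Prop} {w : List ℕ} (h : w ∈ chainWords Rel) :
    w ≠ [] := by
  obtain ⟨-, a, t, rfl, -⟩ := h
  simp

theorem breakSet_subset (Rel : ℕ → ℕ → Prop) : breakSet Rel ⊆ omegaPower (chainDict Rel) := by
  refine subset_omegaPower fun α hα => ?_
  obtain ⟨L₁, m₁, γ₁, hL₁, hlen₁, hb₁, heq₁⟩ := hα 1
  cases L₁ with
  | nil => simp at hlen₁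
  | cons b₀ L₁ =>
  have hb₀ := hL₁ b₀ List.mem_cons_self
  refine ⟨code b₀, ⟨b₀, hb₀, rfl⟩, code_ne_nil (ne_nil_of_mem_chainWords hb₀),
    app (code (L₁.flatten ++ [m₁])) γ₁, fun N => ?_, ?_⟩
  · obtain ⟨L₂, m₂, γ₂, hL₂, hlen₂, hb₂, heq₂⟩ := hα (N + (b₀ :: L₁).flatten.length + 1)
    obtain ⟨t, ht, -⟩ := exists_append_of_app_code (v := (b₀ :: L₁).flatten ++ [m₁])
      (w := L₂.flatten ++ [m₂]) (by
        simp only [List.length_append (bs := [_]), List.length_singleton]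
        omega) (heq₁.symm.trans heq₂)
    obtain ⟨t', ht'⟩ : (b₀ :: L₁).flatten ++ [m₁] <+: L₂.flatten := by
      refine List.prefix_of_prefix_length_le (l₃ := L₂.flatten ++ [m₂]) ⟨t, ht.symm⟩
        (List.prefix_append _ _) ?_
      simp only [List.length_append (bs := [_]), List.length_singleton]
      omega
    have ht'' : L₂.flatten = (b₀ :: L₁).flatten ++ m₁ :: t' := by rw [← ht']; simp
    obtain ⟨La, Lb, rfl, hLa⟩ := exists_cut_of_break (fun b hb => (hL₂ b hb).1) ht'' hb₁
    have hfl : (La ++ Lb).flatten = b₀ ++ (L₁ ++ Lb).flatten := by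
      simp [hLa]
    rw [hfl] at hb₂ hlen₂ heq₂
    refine ⟨L₁ ++ Lb, m₂, γ₂, ?_, ?_, hb₂.of_append ?_, ?_⟩
    · intro b hb
      rcases List.mem_append.1 hb with hb | hb
      · exact hL₁ b (List.mem_cons_of_mem _ hb)
      · exact hL₂ b (List.mem_append_right _ hb)
    · simp only [List.flatten_cons, List.length_append] at hlen₂ ⊢
      omega
    · intro h0
      rw [h0] at hlen₂
      simp only [List.flatten_cons, List.length_append, List.length_nil] at hlen₂
      omega
    · rw [heq₁, List.flatten_cons, List.append_assoc, List.append_assoc, code_append,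
        code_append b₀, app_append, app_append] at heq₂
      exact app_left_cancel heq₂
  · rw [heq₁, List.flatten_cons, List.append_assoc, code_append, app_append]

theorem code_concatPrefix (w : ℕ → List ℕ) (m : ℕ) :
    code (concatPrefix w m) = concatPrefix (fun k => code (w k)) m := by
  induction m with
  | zero => rfl
  | succ m ih => rw [concatPrefix_succ, concatPrefix_succ, code_append, ih]

theorem omegaPower_chainDict_eq {Rel : ℕ → ℕ → Prop}
    (hRel : ¬ ∃ s : ℕ → ℕ, ∀ k, Rel (s k) (s (k + 1) / 2)) :
    omegaPower (chainDict Rel) = breakSet Rel := by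
  refine Set.Subset.antisymm (fun α hα N => ?_) (breakSet_subset Rel)
  obtain ⟨u, s, rfl, hs⟩ := mem_omegaPower_iff_exists_seq.1 hα
  choose w hw hwu using fun k => (hs k).1
  have hchain := fun k => (hw k).1
  choose a t hat hrel using fun k => (hw k).2
  obtain ⟨k, hk, hbr⟩ : ∃ k ≥ N, a (k + 1) / 2 ≠ a k / 2 + (w k).length := by
    by_contra! hcon
    refine hRel ⟨fun k => a (N + k), fun k => ?_⟩
    have := hcon (N + k) (by omega)
    change Rel (a (N + k)) (a (N + k + 1) / 2)
    rw [this]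
    exact hrel _
  have hne : ∀ k, w k ≠ [] := fun k => ne_nil_of_mem_chainWords (hw k)
  have hpre := app_concatPrefix (a := u) (α := s) (fun k => (hs k).2.2) (k + 1)
  have hu : u = fun k => code (w k) := funext fun k => (hwu k).symm
  rw [hu, ← code_concatPrefix] at hpre
  refine ⟨(List.range (k + 1)).map w, a (k + 1), app (code (t (k + 1))) (s (k + 2)), ?_, ?_, ?_, ?_⟩
  · intro b hb
    obtain ⟨i, -, rfl⟩ := List.mem_map.1 hb
    exact hw i
  · have := le_length_concatPrefix hne (k + 1)
    rw [concatPrefix] at this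
    omega
  · change Break (concatPrefix w (k + 1)) _
    rw [concatPrefix_succ]
    refine Break.append ⟨(w k).dropLast, (w k).getLast (hne k),
      (List.dropLast_append_getLast _).symm, fun hc => hbr ?_⟩
    have h1 := hchain k
    have h2 : a k :: t k = (w k).dropLast ++ [(w k).getLast (hne k)] := by
      rw [List.dropLast_append_getLast, hat k]
    rw [hat k] at h1
    have h3 := consec_getLast h1 h2
    have h4 : a (k + 1) / 2 = (w k).getLast (hne k) / 2 + 1 := hc
    have h5 := List.length_pos_iff.2 (hne k)
    rw [List.length_dropLast] at h3
    omega
  · change s 0 = app (code (concatPrefix w (k + 1) ++ [a (k + 1)])) _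
    rw [code_append, app_append, ← app_append (code [a (k + 1)]), ← code_append,
      List.singleton_append, ← hat, hwu, ← (hs (k + 1)).2.2, ← hpre]

theorem isOpen_exists_app {β : Type*} [TopologicalSpace β] [DiscreteTopology β] (u : List β) :
    IsOpen {α : ℕ → β | ∃ γ, α = app u γ} := by
  simp only [exists_eq_app_iff, Set.ofPred_forall]
  have : IsOpen (⋂ i : Fin u.length, {α : ℕ → β | u.get i = α i}) :=
    isOpen_iInter_of_finite fun i =>
      (isOpen_discrete {x | u.get i = x}).preimage (continuous_apply (i : ℕ))
  convert this using 1
  ext α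
  simp [Fin.forall_iff]

theorem breakSet_eq_iInter (Rel : ℕ → ℕ → Prop) :
    ∃ O : ℕ → Set Cantor, (∀ n, IsOpen (O n)) ∧ breakSet Rel = ⋂ n, O n := by
  refine ⟨fun N => {α | ∃ (L : List (List ℕ)) (m : ℕ) (γ : Cantor), (∀ b ∈ L, b ∈ chainWords Rel) ∧
    N ≤ L.flatten.length ∧ Break L.flatten m ∧ α = app (code (L.flatten ++ [m])) γ},
    fun N => ?_, ?_⟩
  · have : IsOpen (⋃ (L : List (List ℕ)) (m : ℕ) (_ : (∀ b ∈ L, b ∈ chainWords Rel) ∧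
        N ≤ L.flatten.length ∧ Break L.flatten m),
        {α : Cantor | ∃ γ, α = app (code (L.flatten ++ [m])) γ}) :=
      isOpen_iUnion fun L => isOpen_iUnion fun m => isOpen_iUnion fun _ => isOpen_exists_app _
    convert this using 1
    ext α
    simp only [Set.mem_ofPred_eq, Set.mem_iUnion, exists_prop, exists_and_left, and_assoc]
  · ext α
    simp [breakSet]

/-! ### Tree representations of analytic sets -/

section tree

open PiNat

theorem isLocallyConstant_res {X : Type*} [TopologicalSpace X] {φ : X → ℕ → ℕ}
    (hφ : Continuous φ) (n : ℕ) : IsLocallyConstant fun x => res (φ x) n := by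
  induction n with
  | zero => exact IsLocallyConstant.const []
  | succ n ih =>
    have h : IsLocallyConstant fun x => φ x n :=
      (IsLocallyConstant.iff_continuous _).2 ((continuous_apply n).comp hφ)
    exact h.comp₂ ih fun a l => a :: l

theorem isClopen_res {X : Type*} [TopologicalSpace X] {φ : X → ℕ → ℕ}
    (hφ : Continuous φ) (n : ℕ) (p : List ℕ → Prop) : IsClopen {x | p (res (φ x) n)} :=
  ⟨⟨isLocallyConstant_res hφ n {l | ¬ p l}⟩, isLocallyConstant_res hφ n {l | p l}⟩

/-- An analytic set is the projection of the set of branches of a tree. -/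
theorem exists_tree {X : Type*} [TopologicalSpace X] {φ : X → ℕ → ℕ} (hφ : Continuous φ)
    (hinj : Function.Injective φ) {Q : Set X} (hQ : AnalyticSet Q) :
    ∃ T : List ℕ → List ℕ → Prop,
      (∀ x ∈ Q, ∃ β, ∀ n, T (res (φ x) n) (res β n)) ∧
      ∀ x β, (∀ N, ∃ n ≥ N, T (res (φ x) n) (res β n)) → x ∈ Q := by
  rw [AnalyticSet] at hQ
  rcases hQ with rfl | ⟨f, hf, rfl⟩
  · refine ⟨fun _ _ => False, fun x hx => hx.elim, fun x β h => ?_⟩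
    obtain ⟨n, -, h⟩ := h 0
    exact h.elim
  · refine ⟨fun u s => ∃ β, res β s.length = s ∧ res (φ (f β)) u.length = u, ?_, ?_⟩
    · rintro _ ⟨β, rfl⟩
      exact ⟨β, fun n => ⟨β, by simp, by simp⟩⟩
    · intro x β h
      choose n hn δ hδ hx using h
      simp only [res_length] at hδ hx
      refine ⟨β, hinj (funext fun k => ?_)⟩
      have hlim : Filter.Tendsto δ Filter.atTop (𝓝 β) := by
        refine tendsto_pi_nhds.2 fun i => tendsto_const_nhds.congr' ?_
        filter_upwards [Filter.eventually_gt_atTop i] with N hN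
        exact (res_eq_res.1 (hδ N) (hN.trans_le (hn N))).symm
      have hcont : Filter.Tendsto (fun N => φ (f (δ N)) k) Filter.atTop (𝓝 (φ (f β) k)) :=
        (((continuous_apply k).comp (hφ.comp hf)).tendsto β).comp hlim
      rw [nhds_discrete, Filter.tendsto_pure] at hcont
      obtain ⟨N, h1, h2⟩ := (hcont.and (Filter.eventually_gt_atTop k)).exists
      rw [← h1]
      exact res_eq_res.1 (hx N) (h2.trans_le (hn N))

theorem exists_continuous_injective_of_zeroDim {X : Type*} [TopologicalSpace X] [T0Space X]
    [SecondCountableTopology X] (hX : ZeroDim X) :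
    ∃ φ : X → ℕ → ℕ, Continuous φ ∧ Function.Injective φ := by
  classical
  obtain ⟨b, hb, hclopen⟩ := hX
  obtain ⟨c, hcb, hc, hbasis⟩ := hb.exists_countable
  obtain ⟨e, he⟩ := (hc.insert ∅).exists_eq_range ⟨∅, Set.mem_insert _ _⟩
  have heclopen : ∀ n, IsClopen (e n) := by
    intro n
    have : e n ∈ insert ∅ c := he ▸ Set.mem_range_self n
    rcases this with h | h
    · rw [h]; exact isClopen_empty
    · exact hclopen _ (hcb h)
  refine ⟨fun x n => if x ∈ e n then 1 else 0, continuous_pi fun n => ?_, fun x y hxy => ?_⟩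
  · refine IsLocallyConstant.continuous ((IsLocallyConstant.iff_exists_open _).2 fun x => ?_)
    by_cases hx : x ∈ e n
    · exact ⟨e n, (heclopen n).isOpen, hx, fun y hy => by simp [hx, hy]⟩
    · refine ⟨(e n)ᶜ, (heclopen n).compl.isOpen, hx, fun y hy => ?_⟩
      rw [Set.mem_compl_iff] at hy
      simp [hx, hy]
  · refine (hbasis.inseparable_iff.2 fun s hs => ?_).eq
    obtain ⟨n, rfl⟩ : s ∈ Set.range e := he ▸ Set.mem_insert_of_mem _ hs
    have := congrFun hxy n
    by_cases h1 : x ∈ e n <;> by_cases h2 : y ∈ e n <;> simp_all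

theorem exists_res_eq (d : ℕ) (l : ℕ → List ℕ) (q : ℕ → ℕ) (hd : (l 0).length = d)
    (h : ∀ k, l (k + 1) = q k :: l k) : ∃ β, ∀ k, res β (d + k) = l k := by
  induction d generalizing l q with
  | zero =>
    refine ⟨q, fun k => ?_⟩
    induction k with
    | zero => simpa using hd
    | succ k ih =>
      rw [Nat.zero_add] at ih ⊢
      rw [res_succ, ih, h]
  | succ d ih =>
    obtain ⟨a, t, hat⟩ : ∃ a t, l 0 = a :: t := List.exists_cons_of_length_eq_add_one hd
    obtain ⟨β, hβ⟩ := ih (fun k => Nat.casesOn k t l) (fun k => Nat.casesOn k a q)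
      (by simpa [hat] using hd) (by
        intro k
        cases k with
        | zero => exact hat
        | succ k => exact h k)
    refine ⟨β, fun k => ?_⟩
    rw [show d + 1 + k = d + (k + 1) by omega]
    exact hβ (k + 1)

/-! ### An analytic set which is not Borel -/

/-- A diagonal analytic subset of the Baire space. -/
def diagSet : Set (ℕ → ℕ) :=
  {y | ∃ γ : ℕ → ℕ, ∀ n, y (Encodable.encode (res y n, res γ n)) = 0}

theorem measurableSet_diag (Z : Type*) [MeasurableSpace Z] {p : Z → List ℕ} {y : Z → ℕ → ℕ}
    {s : Z → List ℕ} (hp : ∀ l, MeasurableSet {z | p z = l}) (hs : ∀ l, MeasurableSet {z | s z = l})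
    (hy : Measurable y) : MeasurableSet {z | y z (Encodable.encode (p z, s z)) = 0} := by
  have : {z | y z (Encodable.encode (p z, s z)) = 0} = ⋃ (l : List ℕ) (r : List ℕ),
      {z | p z = l} ∩ {z | s z = r} ∩ {z | y z (Encodable.encode (l, r)) = 0} := by
    ext z
    simp
  rw [this]
  exact MeasurableSet.iUnion fun l => MeasurableSet.iUnion fun r => ((hp l).inter (hs r)).inter
    (((measurable_pi_apply _).comp hy) (measurableSet_singleton 0))

theorem analyticSet_diagSet : AnalyticSet diagSet := by
  have : diagSet = Prod.fst '' {z : (ℕ → ℕ) × (ℕ → ℕ) |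
      ∀ n, z.1 (Encodable.encode (res z.1 n, res z.2 n)) = 0} := by
    ext y
    simp [diagSet]
  rw [this]
  refine AnalyticSet.image_of_continuous (MeasurableSet.analyticSet ?_) continuous_fst
  rw [Set.ofPred_forall]
  exact MeasurableSet.iInter fun n => measurableSet_diag _
    (fun l => (isClopen_res continuous_fst n (· = l)).isOpen.measurableSet)
    (fun l => (isClopen_res continuous_snd n (· = l)).isOpen.measurableSet) measurable_fst

theorem not_analyticSet_compl_diagSet : ¬ AnalyticSet diagSetᶜ := by
  classical
  intro h
  obtain ⟨T, hT1, hT2⟩ := exists_tree (φ := id) continuous_id Function.injective_id h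
  let z : ℕ → ℕ := fun i => if ∃ u s, Encodable.encode (u, s) = i ∧ T u s then 0 else 1
  have hz : ∀ u s, z (Encodable.encode (u, s)) = 0 ↔ T u s := by
    intro u s
    simp only [z]
    split_ifs with h
    · obtain ⟨u', s', h1, h2⟩ := h
      have := Encodable.encode_injective h1
      simp only [Prod.mk.injEq] at this
      obtain ⟨rfl, rfl⟩ := this
      simpa using h2
    · simp only [false_iff]
      exact fun h' => h ⟨u, s, rfl, h'⟩
  by_cases hmem : z ∈ diagSet
  · obtain ⟨γ, hγ⟩ := hmem
    exact hT2 z γ (fun N => ⟨N, le_rfl, (hz _ _).1 (hγ N)⟩) ⟨γ, hγ⟩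
  · obtain ⟨γ, hγ⟩ := hT1 z hmem
    exact hmem ⟨γ, fun n => (hz _ _).2 (hγ n)⟩

theorem not_measurableSet_diagSet : ¬ MeasurableSet diagSet := fun h =>
  not_analyticSet_compl_diagSet h.compl.analyticSet

/-! ### The reduction -/

/-- The relation between bit-coded nodes and their children, the first components of which
are constrained to lie in the tree `T u`. -/
def treeRel (T : List ℕ → Prop) (a j : ℕ) : Prop :=
  ∃ (l : List (ℕ × ℕ)) (q : ℕ × ℕ), a = 2 * Encodable.encode l + 1 ∧
    j = Encodable.encode (q :: l) ∧ T ((q :: l).map Prod.fst)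

theorem exists_branch_of_treeRel {T : List ℕ → Prop} {s : ℕ → ℕ}
    (hs : ∀ k, treeRel T (s k) (s (k + 1) / 2)) :
    ∃ β : ℕ → ℕ, ∀ N, ∃ n ≥ N, T (res β n) := by
  choose l q h1 h2 h3 using hs
  have hl : ∀ k, l (k + 1) = q k :: l k := by
    intro k
    apply Encodable.encode_injective
    rw [← h2, h1 (k + 1)]
    omega
  obtain ⟨β, hβ⟩ := exists_res_eq _ (fun k => (l k).map Prod.fst) (fun k => (q k).1) rfl
    (fun k => by simp [hl])
  refine ⟨β, fun N => ⟨((l 0).map Prod.fst).length + (N + 1), by omega, ?_⟩⟩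
  rw [hβ (N + 1)]
  have := h3 N
  rwa [← hl] at this

/-- The bit of the node with a given code in the tree of `y`. -/
noncomputable def treeBit (y : ℕ → ℕ) (i : ℕ) : ℕ :=
  open Classical in
  if ∃ l : List (ℕ × ℕ), i = Encodable.encode l ∧
    y (Encodable.encode (res y l.length, l.map Prod.snd)) = 0 then 1 else 0

/-- The letters coding the tree of `y`, from the `i`-th one. -/
noncomputable def treeLetters (y : ℕ → ℕ) (i : ℕ) : ℕ → ℕ :=
  fun k => 2 * (i + k) + treeBit y (i + k)

theorem treeBit_le (y : ℕ → ℕ) (i : ℕ) : treeBit y i ≤ 1 := by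
  unfold treeBit
  split_ifs <;> simp

theorem treeBit_encode (y : ℕ → ℕ) (l : List (ℕ × ℕ)) : treeBit y (Encodable.encode l) = 1 ↔
    y (Encodable.encode (res y l.length, l.map Prod.snd)) = 0 := by
  simp only [treeBit, ite_eq_left_iff, zero_ne_one, imp_false, not_not]
  constructor
  · rintro ⟨l', h, h'⟩
    rwa [Encodable.encode_injective h]
  · exact fun h => ⟨l, rfl, h⟩

theorem measurable_treeBit (i : ℕ) : Measurable fun y => treeBit y i := by
  refine Measurable.ite ?_ measurable_const measurable_const
  simp only [Set.ofPred_exists]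
  refine MeasurableSet.iUnion fun l => MeasurableSet.inter (MeasurableSet.const _) ?_
  exact measurableSet_diag _
    (fun r => (isClopen_res continuous_id l.length (· = r)).isOpen.measurableSet)
    (fun _ => MeasurableSet.const _) measurable_id

theorem measurable_treeLetters (i : ℕ) : Measurable fun y => treeLetters y i :=
  measurable_pi_lambda _ fun k =>
    (measurable_from_nat (f := fun m => 2 * (i + k) + m)).comp (measurable_treeBit (i + k))

/-- The finite word consisting of `n` letters coding the tree of `y`, from the `i`-th one. -/
noncomputable def treeWord (y : ℕ → ℕ) (i n : ℕ) : List ℕ :=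
  (List.range' i n).map fun k => 2 * k + treeBit y k

theorem treeWord_succ (y : ℕ → ℕ) (i n : ℕ) :
    treeWord y i (n + 1) = (2 * i + treeBit y i) :: treeWord y (i + 1) n := by
  simp [treeWord, List.range'_succ]

theorem length_treeWord (y : ℕ → ℕ) (i n : ℕ) : (treeWord y i n).length = n := by
  simp [treeWord]

theorem codeInf_treeLetters (y : ℕ → ℕ) (i n : ℕ) :
    codeInf (treeLetters y i) = app (code (treeWord y i n)) (codeInf (treeLetters y (i + n))) := by
  induction n generalizing i with
  | zero => rfl
  | succ n ih =>
    rw [treeWord_succ, code_cons, app_append, show i + (n + 1) = i + 1 + n by omega, ← ih,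
      ← codeInf_scons]
    congr 1
    funext k
    cases k with
    | zero => rfl
    | succ k =>
      simp only [treeLetters, scons]
      rw [show i + (k + 1) = i + 1 + k by omega]

theorem isChain_treeWord (y : ℕ → ℕ) (i n : ℕ) : (treeWord y i n).IsChain Consec := by
  rw [treeWord, List.isChain_map]
  refine List.IsChain.imp (fun a b h => ?_) (List.isChain_range' i n 1)
  have h1 := treeBit_le y a
  have h2 := treeBit_le y b
  simp only [Consec]
  omega

theorem mem_diagSet_of_mem_omegaPower {T : List ℕ → Prop} {y : ℕ → ℕ}
    (h : codeInf (treeLetters y 0) ∈ omegaPower (chainDict (treeRel T))) : y ∈ diagSet := by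
  have step : ∀ i, codeInf (treeLetters y i) ∈ omegaPower (chainDict (treeRel T)) →
      ∃ j, codeInf (treeLetters y j) ∈ omegaPower (chainDict (treeRel T)) ∧
        treeRel T (2 * i + treeBit y i) j := by
    intro i hi
    obtain ⟨_, ⟨w, ⟨hw, a, t, rfl, hrel⟩, rfl⟩, -, γ, hγ, heq⟩ := exists_app_of_mem_omegaPower hi
    rw [codeInf_treeLetters y i (a :: t).length] at heq
    obtain ⟨h1, rfl⟩ := app_code_inj_of_length (length_treeWord _ _ _) heq
    refine ⟨_, hγ, ?_⟩
    rw [List.length_cons, treeWord_succ, List.cons.injEq] at h1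
    have h2 := treeBit_le y i
    rw [h1.1]
    convert hrel using 1
    omega
  choose! g hg hrel using step
  have hk : ∀ k, codeInf (treeLetters y (g^[k] 0)) ∈ omegaPower (chainDict (treeRel T)) := by
    intro k
    induction k with
    | zero => exact h
    | succ k ih => rw [Function.iterate_succ_apply']; exact hg _ ih
  have hrel' : ∀ k, treeRel T (2 * g^[k] 0 + treeBit y (g^[k] 0)) (g^[k + 1] 0) := by
    intro k
    rw [Function.iterate_succ_apply']
    exact hrel _ (hk k)
  choose l q h1 h2 h3 using hrel'
  have hbit : ∀ k, treeBit y (g^[k] 0) = 1 ∧ g^[k] 0 = Encodable.encode (l k) := by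
    intro k
    have := h1 k
    have := treeBit_le y (g^[k] 0)
    omega
  have hl : ∀ k, l (k + 1) = q k :: l k := fun k =>
    Encodable.encode_injective ((hbit (k + 1)).2.symm.trans (h2 k))
  have hl0 : l 0 = [] := Encodable.encode_injective ((hbit 0).2.symm.trans (by simp))
  obtain ⟨γ, hγ⟩ := exists_res_eq 0 (fun k => (l k).map Prod.snd) (fun k => (q k).2)
    (by simp [hl0]) (fun k => by simp [hl])
  refine ⟨γ, fun n => ?_⟩
  have hn := hγ n
  rw [Nat.zero_add] at hn
  have hb := (hbit n).1
  rw [(hbit n).2, treeBit_encode] at hb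
  have hlen : (l n).length = n := by rw [← List.length_map (f := Prod.snd), ← hn, res_length]
  rwa [hlen, ← hn] at hb

theorem map_res {α β : Type*} (f : α → β) (x : ℕ → α) (n : ℕ) :
    (res x n).map f = res (fun k => f (x k)) n := by
  induction n with
  | zero => rfl
  | succ n ih => rw [res_succ, List.map_cons, ih, res_succ]

theorem mem_omegaPower_of_mem_diagSet {T : List ℕ → Prop} {y β : ℕ → ℕ} (hβ : ∀ n, T (res β n))
    (hy : y ∈ diagSet) :
    codeInf (treeLetters y 0) ∈ omegaPower (chainDict (treeRel T)) := by
  obtain ⟨γ, hγ⟩ := hy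
  let l : ℕ → List (ℕ × ℕ) := res fun k => (β k, γ k)
  have hl : ∀ k, l (k + 1) = (β k, γ k) :: l k := fun k => rfl
  let i : ℕ → ℕ := fun k => Encodable.encode (l k)
  have hlt : ∀ k, i k < i (k + 1) := by
    intro k
    simp only [i, hl, Encodable.encode_list_cons]
    exact Nat.lt_succ_of_le (Nat.right_le_pair _ _)
  have hbit : ∀ k, treeBit y (i k) = 1 := by
    intro k
    rw [treeBit_encode, map_res, res_length]
    exact hγ k
  refine subset_omegaPower (U := Set.range fun k => codeInf (treeLetters y (i k))) ?_
    ⟨0, by simp [i, l]⟩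
  rintro _ ⟨k, rfl⟩
  obtain ⟨n, hn⟩ : ∃ n, i (k + 1) = i k + (n + 1) := ⟨i (k + 1) - i k - 1, by have := hlt k; omega⟩
  refine ⟨code (treeWord y (i k) (n + 1)), ⟨_, ⟨isChain_treeWord _ _ _, _, _, treeWord_succ _ _ _,
    l k, (β k, γ k), ?_, ?_, ?_⟩, rfl⟩, ?_, _, ⟨k + 1, rfl⟩, ?_⟩
  · rw [hbit]
  · rw [length_treeWord, hbit, ← hl]
    change _ = i (k + 1)
    omega
  · rw [← hl, map_res]
    exact hβ _
  · refine code_ne_nil ?_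
    rw [treeWord_succ]
    simp
  · simp only [hn]
    exact codeInf_treeLetters _ _ _

theorem not_measurableSet_omegaPower {T : List ℕ → Prop} {β : ℕ → ℕ} (hβ : ∀ n, T (res β n)) :
    ¬ MeasurableSet (omegaPower (chainDict (treeRel T))) := by
  intro h
  refine not_measurableSet_diagSet ?_
  convert (measurable_codeInf.comp (measurable_treeLetters 0)) h using 1
  ext y
  exact ⟨mem_omegaPower_of_mem_diagSet hβ, mem_diagSet_of_mem_omegaPower⟩

end tree

/-! ### Borel classes -/

theorem mem_sigmaZero_iff {X : Type*} [TopologicalSpace X] {ξ : Ordinal.{0}} (hξ : ¬ ξ ≤ 1)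
    {s : Set X} : s ∈ SigmaZero X ξ ↔ ∃ f : ℕ → Set X,
      (∀ n, ∃ η : Ordinal.{0}, 1 ≤ η ∧ η < ξ ∧ (f n)ᶜ ∈ SigmaZero X η) ∧ s = ⋃ n, f n := by
  rw [SigmaZero, if_neg hξ]
  simp only [exists_prop, Set.mem_ofPred_eq]

theorem mem_sigmaZero_of_le_one {X : Type*} [TopologicalSpace X] {ξ : Ordinal.{0}} (hξ : ξ ≤ 1)
    {s : Set X} : s ∈ SigmaZero X ξ ↔ IsOpen s := by
  rw [SigmaZero, if_pos hξ]
  rfl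

theorem measurableSet_of_mem_sigmaZero {X : Type*} [TopologicalSpace X] [MeasurableSpace X]
    [BorelSpace X] {ξ : Ordinal.{0}} {s : Set X} (hs : s ∈ SigmaZero X ξ) : MeasurableSet s := by
  induction ξ using WellFoundedLT.induction generalizing s with
  | ind ξ ih =>
    by_cases hξ : ξ ≤ 1
    · exact ((mem_sigmaZero_of_le_one hξ).1 hs).measurableSet
    · obtain ⟨f, hf, rfl⟩ := (mem_sigmaZero_iff hξ).1 hs
      refine MeasurableSet.iUnion fun n => ?_
      obtain ⟨η, -, hη, h⟩ := hf n
      exact (ih η hη h).of_compl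

theorem measurableSet_of_mem_piZero {X : Type*} [TopologicalSpace X] [MeasurableSpace X]
    [BorelSpace X] {ξ : Ordinal.{0}} {s : Set X} (hs : s ∈ PiZero X ξ) : MeasurableSet s :=
  MeasurableSet.of_compl (measurableSet_of_mem_sigmaZero hs)

theorem compl_iInter_mem_sigmaZero {X : Type*} [TopologicalSpace X] {ξ : Ordinal.{0}} (hξ : 1 < ξ)
    {O : ℕ → Set X} (hO : ∀ n, IsOpen (O n)) : (⋂ n, O n)ᶜ ∈ SigmaZero X ξ := by
  refine (mem_sigmaZero_iff hξ.not_ge).2 ⟨fun n => (O n)ᶜ, fun n => ⟨1, le_rfl, hξ, ?_⟩, ?_⟩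
  · rw [compl_compl]
    exact (mem_sigmaZero_of_le_one le_rfl).2 (hO n)
  · exact Set.compl_iInter _

theorem iInter_mem_sigmaZero {X : Type*} [TopologicalSpace X] {ξ : Ordinal.{0}} (hξ : 2 < ξ)
    {O : ℕ → Set X} (hO : ∀ n, IsOpen (O n)) : ⋂ n, O n ∈ SigmaZero X ξ := by
  have h12 : (1 : Ordinal.{0}) < 2 := one_lt_two
  exact (mem_sigmaZero_iff (h12.trans hξ).not_ge).2 ⟨fun _ => ⋂ n, O n,
    fun _ => ⟨2, h12.le, hξ, compl_iInter_mem_sigmaZero h12 hO⟩, (Set.iUnion_const _).symm⟩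

/-- Every countable Borel class has a Borel universal set. -/
theorem exists_universal {X : Type*} [TopologicalSpace X] [SecondCountableTopology X]
    [MeasurableSpace X] [BorelSpace X] (ξ : Ordinal.{0}) (hξ : ξ.card ≤ Cardinal.aleph0) :
    ∃ U : Set ((ℕ → ℕ) × X), MeasurableSet U ∧
      ∀ s : Set X, s ∈ SigmaZero X ξ ↔ ∃ c, s = {x | (c, x) ∈ U} := by
  induction ξ using WellFoundedLT.induction with
  | ind ξ ih =>
    by_cases h1 : ξ ≤ 1
    · obtain ⟨b, hb, -, hbasis⟩ := TopologicalSpace.exists_countable_basis X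
      obtain ⟨e, he⟩ := (hb.insert ∅).exists_eq_range ⟨∅, Set.mem_insert _ _⟩
      have heopen : ∀ n, IsOpen (e n) := by
        intro n
        have : e n ∈ insert ∅ b := he ▸ Set.mem_range_self n
        rcases this with h | h
        · rw [h]; exact isOpen_empty
        · exact hbasis.isOpen h
      refine ⟨⋃ (n : ℕ) (k : ℕ), {c : ℕ → ℕ | c n = k} ×ˢ e k,
        MeasurableSet.iUnion fun n => MeasurableSet.iUnion fun k => MeasurableSet.prod
          (measurable_pi_apply (X := fun _ : ℕ => ℕ) n (measurableSet_singleton k))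
          (heopen k).measurableSet, fun s => ?_⟩
      rw [mem_sigmaZero_of_le_one h1]
      have hsec : ∀ c : ℕ → ℕ, {x | (c, x) ∈ ⋃ (n : ℕ) (k : ℕ), {c : ℕ → ℕ | c n = k} ×ˢ e k} =
          ⋃ n, e (c n) := by
        intro c
        ext x
        simp
      simp only [hsec]
      constructor
      · intro hs
        have hex : ∃ c : ℕ → ℕ, Set.range (fun n => e (c n)) = {t ∈ insert ∅ b | t ⊆ s} := by
          obtain ⟨f, hf⟩ := ((hb.insert ∅).mono
            (fun t (ht : t ∈ {t ∈ insert ∅ b | t ⊆ s}) => ht.1)).exists_eq_range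
            ⟨∅, Set.mem_insert _ _, Set.empty_subset _⟩
          have : ∀ n, ∃ k, e k = f n := by
            intro n
            have h2 : f n ∈ {t ∈ insert ∅ b | t ⊆ s} := hf ▸ Set.mem_range_self n
            have h3 := h2.1
            rwa [he] at h3
          choose c hc using this
          exact ⟨c, by rw [hf]; simp only [hc]⟩
        obtain ⟨c, hc⟩ := hex
        refine ⟨c, ?_⟩
        rw [← Set.sUnion_range, hc]
        refine Set.Subset.antisymm (fun x hx => ?_) (Set.sUnion_subset fun t ht => ht.2)
        obtain ⟨t, ht, hxt, hts⟩ := hbasis.exists_subset_of_mem_open hx hs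
        exact ⟨t, ⟨Set.mem_insert_of_mem _ ht, hts⟩, hxt⟩
      · rintro ⟨c, rfl⟩
        exact isOpen_iUnion fun n => heopen _
    · have hcount : (Set.Iio ξ).Countable := by
        rwa [← Cardinal.le_aleph0_iff_set_countable, Cardinal.mk_Iio_ordinal,
          Cardinal.lift_le_aleph0]
      have hI : {η | 1 ≤ η ∧ η < ξ}.Countable := hcount.mono fun η hη => hη.2
      obtain ⟨e, he⟩ := hI.exists_eq_range ⟨1, le_rfl, not_le.1 h1⟩
      have heI : ∀ n, 1 ≤ e n ∧ e n < ξ := fun n => by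
        have : e n ∈ {η | 1 ≤ η ∧ η < ξ} := he ▸ Set.mem_range_self n
        exact this
      choose U hU hsec using fun n => ih (e n) (heI n).2
        ((Ordinal.card_le_card (heI n).2.le).trans hξ)
      let d : ℕ → (ℕ → ℕ) → ℕ → ℕ := fun n c m => c (Nat.pair n (m + 1))
      have hd : ∀ n, Measurable (d n) := fun n =>
        measurable_pi_lambda _ fun m => measurable_pi_apply _
      refine ⟨⋃ (n : ℕ) (k : ℕ), {z | z.1 (Nat.pair n 0) = k} ∩ {z | (d n z.1, z.2) ∈ U k}ᶜ,
        MeasurableSet.iUnion fun n => MeasurableSet.iUnion fun k => MeasurableSet.inter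
          (((measurable_pi_apply (X := fun _ : ℕ => ℕ) _).comp measurable_fst)
            (measurableSet_singleton k))
          (MeasurableSet.compl (((hd n).comp measurable_fst).prodMk measurable_snd (hU k))),
        fun s => ?_⟩
      have hsec' : ∀ c : ℕ → ℕ, {x : X | (c, x) ∈ ⋃ (n : ℕ) (k : ℕ),
          {z : (ℕ → ℕ) × X | z.1 (Nat.pair n 0) = k} ∩ {z | (d n z.1, z.2) ∈ U k}ᶜ} =
          ⋃ n, {x | (d n c, x) ∈ U (c (Nat.pair n 0))}ᶜ := by
        intro c
        ext x
        simp
      simp only [hsec']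
      rw [mem_sigmaZero_iff h1]
      constructor
      · rintro ⟨f, hf, rfl⟩
        have : ∀ n, ∃ (k : ℕ) (c : ℕ → ℕ), (f n)ᶜ = {x | (c, x) ∈ U k} := by
          intro n
          obtain ⟨η, h2, h3, h4⟩ := hf n
          obtain ⟨k, rfl⟩ : η ∈ Set.range e := he ▸ ⟨h2, h3⟩
          obtain ⟨c, hc⟩ := (hsec k _).1 h4
          exact ⟨k, c, hc⟩
        choose k c hkc using this
        let c' : ℕ → ℕ := fun i =>
          Nat.casesOn (Nat.unpair i).2 (k (Nat.unpair i).1) (c (Nat.unpair i).1)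
        have hc0 : ∀ n, c' (Nat.pair n 0) = k n := fun n => by simp [c']
        have hc1 : ∀ n, d n c' = c n := fun n => by funext m; simp [c', d]
        refine ⟨c', Set.iUnion_congr fun n => ?_⟩
        rw [hc0, hc1, ← hkc, compl_compl]
      · rintro ⟨c, rfl⟩
        refine ⟨_, fun n => ⟨e (c (Nat.pair n 0)), (heI _).1, (heI _).2, ?_⟩, rfl⟩
        rw [compl_compl]
        exact (hsec _ _).2 ⟨_, rfl⟩

/-! ### The upper bound -/

theorem continuous_app {β : Type*} [TopologicalSpace β] (u : List β) :
    Continuous (app u : (ℕ → β) → (ℕ → β)) := by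
  induction u with
  | nil => exact continuous_id
  | cons a u ih =>
    refine continuous_pi fun n => ?_
    cases n with
    | zero => exact continuous_const
    | succ n => exact (continuous_apply n).comp ih

theorem continuous_shift {β : Type*} [TopologicalSpace β] (n : ℕ) :
    Continuous (shift n : (ℕ → β) → (ℕ → β)) :=
  continuous_pi fun _ => continuous_apply _

theorem polishSpace_of_discrete {β : Type*} [TopologicalSpace β] [DiscreteTopology β]
    [Countable β] : PolishSpace β := by
  obtain ⟨f, hf⟩ := exists_injective_nat β
  exact (Topology.IsClosedEmbedding.of_continuous_injective_isClosedMap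
    continuous_of_discreteTopology hf fun _ _ => isClosed_discrete _).polishSpace

instance : PolishSpace Bool := polishSpace_of_discrete

instance (n : ℕ) : PolishSpace (Fin n) := polishSpace_of_discrete

theorem measurableSet_dict (u : List (Fin 2)) :
    MeasurableSet {A : List (Fin 2) → Bool | A u = true} :=
  measurable_pi_apply (X := fun _ : List (Fin 2) => Bool) u (measurableSet_singleton true)

theorem analyticSet_graph_omegaPower :
    AnalyticSet {z : (List (Fin 2) → Bool) × Cantor | z.2 ∈ omegaPower {w | z.1 w = true}} := by
  let P : Set ((List (Fin 2) → Bool) × (ℕ → ℕ) × (ℕ → Cantor)) :=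
    {p | ∀ k, ∃ u : List (Fin 2), p.2.1 k = Encodable.encode u ∧ p.1 u = true ∧ u ≠ [] ∧
      p.2.2 k = app u (p.2.2 (k + 1))}
  have hP : MeasurableSet P := by
    simp only [P, Set.ofPred_forall, Set.ofPred_exists]
    refine MeasurableSet.iInter fun k => MeasurableSet.iUnion fun u => ?_
    refine MeasurableSet.inter ?_ (MeasurableSet.inter ?_ (MeasurableSet.inter
      (MeasurableSet.const _) ?_))
    · exact ((measurable_pi_apply k).comp (measurable_fst.comp measurable_snd))
        (measurableSet_singleton _)
    · exact measurable_fst (measurableSet_dict u)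
    · have h : ∀ k, Continuous fun p : (List (Fin 2) → Bool) × (ℕ → ℕ) × (ℕ → Cantor) =>
          p.2.2 k := fun k => (continuous_apply k).comp (continuous_snd.comp continuous_snd)
      exact (isClosed_eq (h k) ((continuous_app u).comp (h (k + 1)))).measurableSet
  have : {z : (List (Fin 2) → Bool) × Cantor | z.2 ∈ omegaPower {w | z.1 w = true}} =
      (fun p : (List (Fin 2) → Bool) × (ℕ → ℕ) × (ℕ → Cantor) => (p.1, p.2.2 0)) '' P := by
    ext ⟨A, α⟩
    simp only [Set.mem_ofPred_eq, mem_omegaPower_iff_exists_seq, Set.mem_image, Prod.mk.injEq, P,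
      Prod.exists]
    constructor
    · rintro ⟨w, s, rfl, h⟩
      exact ⟨A, fun k => Encodable.encode (w k), s, fun k => ⟨w k, rfl, h k⟩, rfl, rfl⟩
    · rintro ⟨A, a, s, h, rfl, rfl⟩
      choose w _ h using h
      exact ⟨w, s, rfl, h⟩
  rw [this]
  exact hP.analyticSet.image_of_continuous (by fun_prop)

/-- The set of dictionaries whose ω-power is a section of a fixed Borel set is `Σ¹₂`. -/
theorem sigma12_omegaPower_mem_sections {U : Set ((ℕ → ℕ) × Cantor)} (hU : MeasurableSet U) :
    Sigma12 {A : List (Fin 2) → Bool | ∃ c, omegaPower {w | A w = true} = {x | (c, x) ∈ U}} := by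
  refine ⟨{z | omegaPower {w | z.1 w = true} = {x | (z.2, x) ∈ U}}, ?_, by ext A; simp⟩
  let B₁ : Set (((List (Fin 2) → Bool) × (ℕ → ℕ)) × Cantor) :=
    {z | z.2 ∈ omegaPower {w | z.1.1 w = true}} ∩ {z | (z.1.2, z.2) ∈ U}ᶜ
  let B₂ : Set (((List (Fin 2) → Bool) × (ℕ → ℕ)) × Cantor) :=
    {z | (z.1.2, z.2) ∈ U} ∩ {z | ∃ u : List (Fin 2), z.1.1 u = true ∧ u ≠ [] ∧
      z.2 = app u (shift u.length z.2) ∧ (z.1.2, shift u.length z.2) ∈ U}ᶜ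
  have hUm : MeasurableSet {z : ((List (Fin 2) → Bool) × (ℕ → ℕ)) × Cantor | (z.1.2, z.2) ∈ U} :=
    ((measurable_snd.comp measurable_fst).prodMk measurable_snd) hU
  have h₁ : AnalyticSet B₁ := by
    have := (analyticSet_graph_omegaPower.preimage
      (f := fun z : ((List (Fin 2) → Bool) × (ℕ → ℕ)) × Cantor => (z.1.1, z.2)) (by fun_prop))
    rw [show B₁ = ⋂ b : Bool, cond b {z | z.2 ∈ omegaPower {w | z.1.1 w = true}}
      {z | (z.1.2, z.2) ∈ U}ᶜ from Set.inter_eq_iInter]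
    refine AnalyticSet.iInter fun b => ?_
    cases b
    · exact hUm.compl.analyticSet
    · exact this
  have h₂ : MeasurableSet B₂ := by
    refine hUm.inter (MeasurableSet.compl ?_)
    simp only [Set.ofPred_exists]
    refine MeasurableSet.iUnion fun u => ?_
    refine MeasurableSet.inter ?_ (MeasurableSet.inter (MeasurableSet.const _)
      (MeasurableSet.inter ?_ ?_))
    · exact (measurable_fst.comp measurable_fst) (measurableSet_dict u)
    · exact (isClosed_eq continuous_snd
        ((continuous_app u).comp ((continuous_shift _).comp continuous_snd))).measurableSet
    · exact ((measurable_snd.comp measurable_fst).prodMk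
        ((measurable_shift _).comp measurable_snd)) hU
  have hB : AnalyticSet (Prod.fst '' (B₁ ∪ B₂)) := by
    rw [Set.union_eq_iUnion]
    refine AnalyticSet.image_of_continuous (AnalyticSet.iUnion fun b => ?_) continuous_fst
    cases b
    · exact h₂.analyticSet
    · exact h₁
  rw [Coanalytic]
  convert hB using 1
  ext ⟨A, c⟩
  simp only [Set.mem_compl_iff, Set.mem_ofPred_eq, omegaPower_eq_iff, Set.mem_image,
    Prod.exists, exists_and_right, exists_eq_right, not_and_or, Set.not_subset, not_forall,
    Set.mem_union, B₁, B₂, Set.mem_inter_iff, exists_or, exists_prop]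
  refine or_congr Iff.rfl (exists_congr fun α => and_congr Iff.rfl (not_congr
    (exists_congr fun u => and_congr Iff.rfl (and_congr Iff.rfl ?_))))
  constructor
  · rintro ⟨γ, hγ, rfl⟩
    rw [shift_app]
    exact ⟨rfl, hγ⟩
  · rintro ⟨h1, h2⟩
    exact ⟨_, h2, h1⟩

theorem sigma12_sigmaDict {ξ : Ordinal.{0}} (hξ : ξ.card ≤ Cardinal.aleph0) :
    Sigma12 (SigmaDict ξ) := by
  obtain ⟨U, hU, hsec⟩ := exists_universal (X := Cantor) ξ hξ
  convert sigma12_omegaPower_mem_sections hU using 1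
  ext A
  exact hsec _

theorem sigma12_piDict {ξ : Ordinal.{0}} (hξ : ξ.card ≤ Cardinal.aleph0) :
    Sigma12 (PiDict ξ) := by
  obtain ⟨U, hU, hsec⟩ := exists_universal (X := Cantor) ξ hξ
  convert sigma12_omegaPower_mem_sections hU.compl using 1
  ext A
  refine (hsec _).trans (exists_congr fun c => ?_)
  rw [compl_eq_comm, eq_comm]
  rfl

/-! ### The lower bound -/

theorem continuous_chainDict {X : Type*} [TopologicalSpace X] {Rel : X → ℕ → ℕ → Prop}
    (hRel : ∀ a j, IsClopen {x | Rel x a j}) :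
    Continuous fun (x : X) (u : List (Fin 2)) =>
      (chainDict (Rel x)).boolIndicator u := by
  refine continuous_pi fun u => ?_
  have : IsClopen {x | u ∈ chainDict (Rel x)} := by
    by_cases hu : ∃ a t, u = code (a :: t) ∧ (a :: t).IsChain Consec
    · obtain ⟨a, t, rfl, hc⟩ := hu
      convert hRel a (a / 2 + (a :: t).length) using 1
      ext x
      simp only [chainDict, code_injective.mem_set_image, Set.mem_ofPred_eq, chainWords]
      constructor
      · rintro ⟨-, a', t', h, h'⟩
        obtain ⟨rfl, rfl⟩ := List.cons.inj h
        exact h'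
      · exact fun h => ⟨hc, a, t, rfl, h⟩
    · convert isClopen_empty (X := X) using 1
      refine Set.eq_empty_of_forall_notMem fun x => ?_
      rintro ⟨w, ⟨hc, a, t, rfl, -⟩, rfl⟩
      exact hu ⟨a, t, rfl, hc⟩
  exact (continuous_boolIndicator_iff_isClopen _).2 this

theorem isClopen_treeRel {X : Type*} [TopologicalSpace X] {T : X → List ℕ → Prop}
    (hT : ∀ s, IsClopen {x | T x s}) (a j : ℕ) : IsClopen {x | treeRel (T x) a j} := by
  by_cases h : ∃ (l : List (ℕ × ℕ)) (q : ℕ × ℕ), a = 2 * Encodable.encode l + 1 ∧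
      j = Encodable.encode (q :: l)
  · obtain ⟨l, q, ha, hj⟩ := h
    convert hT ((q :: l).map Prod.fst) using 1
    ext x
    constructor
    · rintro ⟨l', q', -, hj', h⟩
      rwa [Encodable.encode_injective (hj.symm.trans hj')]
    · exact fun h => ⟨l, q, ha, hj, h⟩
  · convert isClopen_empty (X := X) using 1
    refine Set.eq_empty_of_forall_notMem fun x => ?_
    rintro ⟨l, q, ha, hj, -⟩
    exact h ⟨l, q, ha, hj⟩

/-- A coanalytic set can be reduced continuously to the dictionaries with a `Π⁰₂` ω-power,
in such a way that the points outside the set have a non-Borel ω-power. -/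
theorem exists_reduction {X : Type*} [TopologicalSpace X] [T0Space X]
    [SecondCountableTopology X] (hX : ZeroDim X) {P : Set X} (hP : Coanalytic P) :
    ∃ f : X → (List (Fin 2) → Bool), Continuous f ∧
      (∀ x ∈ P, ∃ O : ℕ → Set Cantor, (∀ n, IsOpen (O n)) ∧
        omegaPower {w | f x w = true} = ⋂ n, O n) ∧
      ∀ x ∉ P, ¬ MeasurableSet (omegaPower {w | f x w = true}) := by
  obtain ⟨φ, hφ, hinj⟩ := exists_continuous_injective_of_zeroDim hX
  obtain ⟨T, hT1, hT2⟩ := exists_tree hφ hinj hP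
  let T' : X → List ℕ → Prop := fun x s => T (PiNat.res (φ x) s.length) s
  have hset : ∀ x, {w | (chainDict (treeRel (T' x))).boolIndicator w = true} =
      chainDict (treeRel (T' x)) := fun x => by
    ext w
    exact (Set.mem_iff_boolIndicator _ w).symm
  refine ⟨fun x u => (chainDict (treeRel (T' x))).boolIndicator u,
    continuous_chainDict (isClopen_treeRel fun s => isClopen_res hφ _ fun u => T u s), ?_, ?_⟩
  · intro x hx
    rw [hset, omegaPower_chainDict_eq]
    · exact breakSet_eq_iInter _
    · rintro ⟨s, hs⟩
      obtain ⟨β, hβ⟩ := exists_branch_of_treeRel hs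
      exact hT2 x β (by simpa [T'] using hβ) hx
  · intro x hx
    obtain ⟨β, hβ⟩ := hT1 x hx
    rw [hset]
    exact not_measurableSet_omegaPower (β := β) (by simpa [T'] using hβ)

theorem exists_reduction_dict {X : Type*} [TopologicalSpace X] [T0Space X]
    [SecondCountableTopology X] (hX : ZeroDim X) {P : Set X} (hP : Coanalytic P)
    {ξ : Ordinal.{0}} (hξ : 2 < ξ) :
    ∃ f : X → (List (Fin 2) → Bool), Continuous f ∧ P = f ⁻¹' SigmaDict ξ ∧
      P = f ⁻¹' PiDict ξ := by
  obtain ⟨f, hf, h1, h2⟩ := exists_reduction hX hP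
  refine ⟨f, hf, ?_, ?_⟩
  · refine Set.Subset.antisymm (fun x hx => ?_) fun x hx => ?_
    · obtain ⟨O, hO, heq⟩ := h1 x hx
      change omegaPower {w | f x w = true} ∈ SigmaZero Cantor ξ
      rw [heq]
      exact iInter_mem_sigmaZero hξ hO
    · by_contra hxP
      exact h2 x hxP (measurableSet_of_mem_sigmaZero hx)
  · refine Set.Subset.antisymm (fun x hx => ?_) fun x hx => ?_
    · obtain ⟨O, hO, heq⟩ := h1 x hx
      change (omegaPower {w | f x w = true})ᶜ ∈ SigmaZero Cantor ξ
      rw [heq]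
      exact compl_iInter_mem_sigmaZero (one_lt_two.trans hξ) hO
    · by_contra hxP
      exact h2 x hxP (measurableSet_of_mem_piZero hx)

theorem zeroDim_baire : ZeroDim (ℕ → ℕ) := by
  refine ⟨_, isTopologicalBasis_pi fun _ => isTopologicalBasis_opens, ?_⟩
  rintro _ ⟨U, F, -, rfl⟩
  exact ⟨isClosed_set_pi fun i _ => isClosed_discrete _,
    isOpen_set_pi F.finite_toSet fun i _ => isOpen_discrete _⟩

/-- A set to which all coanalytic subsets of the Baire space reduce continuously is not
analytic. -/
theorem not_analyticSet_of_reduction {Y : Type} [TopologicalSpace Y] [T2Space Y] {S : Set Y}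
    {f : (ℕ → ℕ) → Y} (hf : Continuous f) (h : diagSetᶜ = f ⁻¹' S) : ¬ AnalyticSet S := fun hS =>
  not_analyticSet_compl_diagSet (h ▸ hS.preimage hf)

/-- For every countable ordinal ξ ≥ 3, the sets Σ_ξ and Π_ξ of dictionaries are
Π¹₁-hard, and they are Σ¹₂ but not analytic. -/
theorem sigma_pi_dict_pi11_hard (ξ : Ordinal.{0}) (hξ : 3 ≤ ξ)
    (hcount : ξ.card ≤ Cardinal.aleph0) :
    (∀ (X : Type) [TopologicalSpace X] [PolishSpace X], ZeroDim X →
      ∀ P : Set X, Coanalytic P →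
        ∃ f : X → (List (Fin 2) → Bool), Continuous f ∧ P = f ⁻¹' SigmaDict ξ) ∧
    (∀ (X : Type) [TopologicalSpace X] [PolishSpace X], ZeroDim X →
      ∀ P : Set X, Coanalytic P →
        ∃ f : X → (List (Fin 2) → Bool), Continuous f ∧ P = f ⁻¹' PiDict ξ) ∧
    Sigma12 (SigmaDict ξ) ∧ ¬ MeasureTheory.AnalyticSet (SigmaDict ξ) ∧
    Sigma12 (PiDict ξ) ∧ ¬ MeasureTheory.AnalyticSet (PiDict ξ) := by
  have h2 : (2 : Ordinal.{0}) < ξ := lt_of_lt_of_le (by norm_num) hξ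
  obtain ⟨g, hg, hgS, hgP⟩ := exists_reduction_dict zeroDim_baire (P := diagSetᶜ)
    (by rw [Coanalytic, compl_compl]; exact analyticSet_diagSet) h2
  refine ⟨fun X _ _ hX P hP => ?_, fun X _ _ hX P hP => ?_, sigma12_sigmaDict hcount,
    not_analyticSet_of_reduction hg hgS, sigma12_piDict hcount,
    not_analyticSet_of_reduction hg hgP⟩
  · obtain ⟨f, hf, hS, -⟩ := exists_reduction_dict hX hP h2
    exact ⟨f, hf, hS⟩
  · obtain ⟨f, hf, -, hP'⟩ := exists_reduction_dict hX hP h2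
    exact ⟨f, hf, hP'⟩
end

section
/- There exist an analytic set U ⊆ 2^ω × 2^ω which is a good universal set for the class of analytic subsets of 2^ω, and a continuous map c : 2^{2^{<ω}} → 2^ω, such that for every A ⊆ 2^{<ω} one has A^∞ = U_{c(A)} := {β ∈ 2^ω : (c(A),β) ∈ U}. -/
open Topology MeasureTheory TopologicalSpace

/-- `U ⊆ 2^ω × 2^ω` is a good universal set for the class whose instances at the spaces
`2^ω`, `2^ω × 2^ω` and `2^ω × (2^ω × 2^ω)` are `Γ₁`, `Γ₂`, `Γ₃`: `U` is in the class,
its sections are exactly the `Γ₁` sets, and for every `V` universal for `Γ₂` there is a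
continuous `S` with `(S(α,β),γ) ∈ U ↔ (α,β,γ) ∈ V`. -/
def IsGoodUniversal (Γ₁ : Set (Set Cantor)) (Γ₂ : Set (Set (Cantor × Cantor)))
    (Γ₃ : Set (Set (Cantor × Cantor × Cantor))) (U : Set (Cantor × Cantor)) : Prop :=
  U ∈ Γ₂ ∧
  Γ₁ = {s | ∃ α, s = {β | (α, β) ∈ U}} ∧
  ∀ V : Set (Cantor × Cantor × Cantor), V ∈ Γ₃ →
    Γ₂ = {s | ∃ α, s = {p | (α, p) ∈ V}} →
    ∃ S : Cantor × Cantor → Cantor, Continuous S ∧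
      ∀ α β γ, (S (α, β), γ) ∈ U ↔ (α, β, γ) ∈ V

instance : PolishSpace Cantor := ⟨⟩

instance : PolishSpace (List (Fin 2) → Bool) := ⟨⟩

/-- Every Polish space `X` has an analytic set `W ⊆ 2^ω × X` universal for the analytic subsets
of `X`. -/
theorem exists_universal_analyticSet (X : Type*) [TopologicalSpace X] [PolishSpace X] :
    ∃ W : Set (Cantor × X), AnalyticSet W ∧
      ∀ s : Set X, AnalyticSet s → ∃ ε : Cantor, ∀ x, (ε, x) ∈ W ↔ x ∈ s := by
  obtain ⟨b, hb_countable, -, hb⟩ := exists_countable_basis (X × (ℕ → ℕ))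
  obtain ⟨B, hB⟩ : ∃ B : ℕ → Set (X × (ℕ → ℕ)), insert ∅ b = Set.range B :=
    (hb_countable.insert ∅).exists_eq_range (Set.insert_nonempty _ _)
  have hB_open (n : ℕ) : IsOpen (B n) := by
    have hn : B n ∈ insert ∅ b := hB ▸ Set.mem_range_self n
    rcases hn with hn | hn
    · exact hn ▸ isOpen_empty
    · exact hb.isOpen hn
  let C : Set (Cantor × X × (ℕ → ℕ)) := {p | ∀ n, p.1 n = 1 → p.2 ∉ B n}
  have hC : IsClosed C := by
    have : C = ⋂ n, ({p | p.1 n = 1} ∩ {p | p.2 ∈ B n})ᶜ := by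
      ext p; simp [C]
    rw [this]
    refine isClosed_iInter fun n => (IsOpen.inter ?_ ?_).isClosed_compl
    · exact (isOpen_discrete {(1 : Fin 2)}).preimage
        (by fun_prop : Continuous fun p : Cantor × X × (ℕ → ℕ) => p.1 n)
    · exact (hB_open n).preimage continuous_snd
  have hC_section (D : Set (X × (ℕ → ℕ))) (hD : IsClosed D) :
      ∃ ε : Cantor, ∀ q, (ε, q) ∈ C ↔ q ∈ D := by
    classical
    refine ⟨fun n => if B n ⊆ Dᶜ then 1 else 0, fun q => ⟨fun hq => ?_, fun hq n hn hqn => ?_⟩⟩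
    · by_contra hqD
      obtain ⟨u, hu, hqu, huD⟩ := hb.exists_subset_of_mem_open (show q ∈ Dᶜ from hqD)
        hD.isOpen_compl
      obtain ⟨n, rfl⟩ : u ∈ Set.range B := hB ▸ Set.mem_insert_of_mem _ hu
      exact hq n (if_pos huD) hqu
    · by_cases h : B n ⊆ Dᶜ
      · exact h hqn hq
      · simp [h] at hn
  refine ⟨(fun p : Cantor × X × (ℕ → ℕ) => (p.1, p.2.1)) '' C,
    hC.analyticSet.image_of_continuous (by fun_prop), fun s hs => ?_⟩
  obtain ⟨D, hD, hDs⟩ : ∃ D : Set (X × (ℕ → ℕ)), IsClosed D ∧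
      ∀ x, (∃ y, (x, y) ∈ D) ↔ x ∈ s := by
    rw [AnalyticSet] at hs
    rcases hs with rfl | ⟨f, hf, rfl⟩
    · exact ⟨∅, isClosed_empty, by simp⟩
    · refine ⟨{q | f q.2 = q.1}, isClosed_eq (by fun_prop) (by fun_prop), by simp⟩
  obtain ⟨ε, hε⟩ := hC_section D hD
  refine ⟨ε, fun x => ?_⟩
  rw [← hDs]
  constructor
  · rintro ⟨⟨ε', x', y⟩, hp, heq⟩
    obtain ⟨rfl, rfl⟩ := Prod.mk.inj heq
    exact ⟨y, (hε _).1 hp⟩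
  · rintro ⟨y, hy⟩
    exact ⟨(ε, x, y), (hε _).2 hy, rfl⟩

/-- The interleaving of two binary sequences. -/
def interleave (p : Cantor × Cantor) : Cantor :=
  fun n => if n % 2 = 0 then p.1 (n / 2) else p.2 (n / 2)

/-- The even and odd parts of a binary sequence. -/
def deinterleave (γ : Cantor) : Cantor × Cantor :=
  (fun n => γ (2 * n), fun n => γ (2 * n + 1))

theorem deinterleave_interleave (p : Cantor × Cantor) : deinterleave (interleave p) = p := by
  ext n
  · simp [deinterleave, interleave]
  · have : (2 * n + 1) / 2 = n := by omega
    simp [deinterleave, interleave, this]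

theorem continuous_interleave : Continuous interleave := by
  refine continuous_pi fun n => ?_
  unfold interleave
  split_ifs <;> fun_prop

theorem continuous_deinterleave : Continuous deinterleave := by
  unfold deinterleave
  fun_prop

/-- There is an analytic subset of the square of the Cantor space to which every analytic subset
reduces continuously in the first coordinate. -/
theorem exists_analyticSet_forall_reduction :
    ∃ U : Set (Cantor × Cantor), AnalyticSet U ∧
      ∀ P : Set (Cantor × Cantor), AnalyticSet P →
        ∃ f : Cantor → Cantor, Continuous f ∧ ∀ α β, (f α, β) ∈ U ↔ (α, β) ∈ P := by
  obtain ⟨W, hW, hW_univ⟩ := exists_universal_analyticSet (Cantor × Cantor)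
  have := continuous_deinterleave
  refine ⟨(fun p : Cantor × Cantor =>
    ((deinterleave p.1).1, (deinterleave p.1).2, p.2)) ⁻¹' W,
    hW.preimage (by fun_prop), fun P hP => ?_⟩
  obtain ⟨ε, hε⟩ := hW_univ P hP
  refine ⟨fun α => interleave (ε, α), continuous_interleave.comp (by fun_prop), fun α β => ?_⟩
  simp [deinterleave_interleave, hε]

/-- An enumeration of the finite binary words. -/
def natWord (n : ℕ) : List (Fin 2) := (Encodable.decode n).getD []

theorem natWord_encode (w : List (Fin 2)) : natWord (Encodable.encode w) = w := by
  simp [natWord]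

theorem isLocallyConstant_concatPrefix (m : ℕ) :
    IsLocallyConstant fun y : ℕ → ℕ => concatPrefix (fun i => natWord (y i)) m := by
  induction m with
  | zero => exact IsLocallyConstant.const _
  | succ m ih =>
    have hm : IsLocallyConstant fun y : ℕ → ℕ => natWord (y m) :=
      ((IsLocallyConstant.iff_continuous fun y : ℕ → ℕ => y m).2 (continuous_apply m)).comp natWord
    simpa [concatPrefix, List.range_succ] using ih.comp₂ hm (· ++ ·)

/-- Membership in an ω-power is analytic, uniformly in the dictionary. -/
theorem analyticSet_setOf_mem_omegaPower :
    AnalyticSet {p : (List (Fin 2) → Bool) × Cantor | p.2 ∈ omegaPower {w | p.1 w = true}} := by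
  let word (y : ℕ → ℕ) (i : ℕ) : List (Fin 2) := natWord (y i)
  let Z := ((List (Fin 2) → Bool) × Cantor) × (ℕ → ℕ)
  let M : Set Z := {z | (∀ i, z.1.1 (word z.2 i) = true) ∧
    (∀ n, ∃ m, n ≤ (concatPrefix (word z.2) m).length) ∧
    ∀ (m k : ℕ) (h : k < (concatPrefix (word z.2) m).length),
      (concatPrefix (word z.2) m).get ⟨k, h⟩ = z.1.2 k}
  have hM : AnalyticSet M := by
    borelize Z
    have hconcat (m : ℕ) : IsLocallyConstant fun z : Z => concatPrefix (word z.2) m :=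
      (isLocallyConstant_concatPrefix m).comp_continuous continuous_snd
    refine MeasurableSet.analyticSet ?_
    simp only [M, Set.ofPred_and]
    refine MeasurableSet.inter ?_ (MeasurableSet.inter ?_ ?_)
    · rw [Set.ofPred_forall]
      refine MeasurableSet.iInter fun i => IsOpen.measurableSet ?_
      have : {z : Z | z.1.1 (word z.2 i) = true} =
          ⋃ n : ℕ, {z : Z | z.2 i = n} ∩ {z : Z | z.1.1 (natWord n) = true} := by
        ext z; simp [word]
      rw [this]
      refine isOpen_iUnion fun n => IsOpen.inter ?_ ?_
      · have hi : Continuous fun z : Z => z.2 i := (continuous_apply i).comp continuous_snd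
        exact (isOpen_discrete {n}).preimage hi
      · have hn : Continuous fun z : Z => z.1.1 (natWord n) :=
          (continuous_apply (natWord n)).comp (continuous_fst.comp continuous_fst)
        exact (isOpen_discrete {true}).preimage hn
    · simp only [Set.ofPred_forall, Set.ofPred_exists]
      exact MeasurableSet.iInter fun n => MeasurableSet.iUnion fun m =>
        (hconcat m {l | n ≤ l.length}).measurableSet
    · rw [Set.ofPred_forall]
      refine MeasurableSet.iInter fun m => ?_
      rw [Set.ofPred_forall]
      refine MeasurableSet.iInter fun k => IsOpen.measurableSet ?_
      have hk : IsLocallyConstant fun z : Z => z.1.2 k :=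
        (IsLocallyConstant.iff_continuous _).2 (by fun_prop)
      exact (hconcat m).prodMk hk
        {q : List (Fin 2) × Fin 2 | ∀ h : k < q.1.length, q.1.get ⟨k, h⟩ = q.2}
  convert hM.image_of_continuous continuous_fst using 1
  ext ⟨A, β⟩
  constructor
  · rintro ⟨a, ha⟩
    have hword : word (fun i => Encodable.encode (a i)) = a := by
      funext i; simp [word, natWord_encode]
    refine ⟨((A, β), fun i => Encodable.encode (a i)), ?_, rfl⟩
    change _ ∧ _
    dsimp only
    rw [hword]
    exact ha
  · rintro ⟨⟨p, y⟩, hz, rfl⟩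
    exact ⟨word y, hz⟩

/-- There is a good universal set U for the analytic subsets of 2^ω and a continuous map
c : 2^{2^{<ω}} → 2^ω such that A^∞ = U_{c(A)} for every dictionary A ⊆ 2^{<ω}. -/
theorem omega_powers_uniformly_analytic :
    ∃ U : Set (Cantor × Cantor),
      IsGoodUniversal {s | MeasureTheory.AnalyticSet s} {s | MeasureTheory.AnalyticSet s}
        {s | MeasureTheory.AnalyticSet s} U ∧
      ∃ c : (List (Fin 2) → Bool) → Cantor, Continuous c ∧
        ∀ A : List (Fin 2) → Bool,
          omegaPower {w | A w = true} = {β : Cantor | (c A, β) ∈ U} := by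
  obtain ⟨U, hU, hred⟩ := exists_analyticSet_forall_reduction
  refine ⟨U, ⟨hU, ?_, fun V hV _ => ?_⟩, ?_⟩
  · ext s
    constructor
    · intro hs
      obtain ⟨f, -, hf⟩ := hred (Prod.snd ⁻¹' s) (AnalyticSet.preimage hs continuous_snd)
      exact ⟨f 0, by ext β; simp [hf]⟩
    · rintro ⟨α, rfl⟩
      exact hU.preimage (by fun_prop : Continuous fun β : Cantor => (α, β))
  · have := continuous_deinterleave
    obtain ⟨f, hf, hfV⟩ := hred ((fun p : Cantor × Cantor =>
      ((deinterleave p.1).1, (deinterleave p.1).2, p.2)) ⁻¹' V)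
      (AnalyticSet.preimage hV (by fun_prop))
    refine ⟨f ∘ interleave, hf.comp continuous_interleave, fun α β γ => ?_⟩
    simp [hfV, deinterleave_interleave]
  · let dict (γ : Cantor) (w : List (Fin 2)) : Bool := decide (γ (Encodable.encode w) = 1)
    let code (A : List (Fin 2) → Bool) : Cantor :=
      fun n => if A (natWord n) then 1 else 0
    have hdict : Continuous dict := continuous_pi fun w =>
      (continuous_of_discreteTopology (f := fun i : Fin 2 => decide (i = 1))).comp
        (continuous_apply (Encodable.encode w))
    have hcode : Continuous code := continuous_pi fun n =>
      (continuous_of_discreteTopology (f := fun t : Bool => if t then (1 : Fin 2) else 0)).comp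
        (continuous_apply (natWord n))
    have hdict_code (A : List (Fin 2) → Bool) : dict (code A) = A := by
      funext w
      cases h : A w <;> simp [dict, code, natWord_encode, h]
    obtain ⟨f, hf, hfP⟩ := hred ((fun p : Cantor × Cantor => (dict p.1, p.2)) ⁻¹'
      {p | p.2 ∈ omegaPower {w | p.1 w = true}})
      (analyticSet_setOf_mem_omegaPower.preimage (by fun_prop))
    refine ⟨f ∘ code, hf.comp hcode, fun A => ?_⟩
    ext β
    simp [hfP, hdict_code]
end
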